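/- arXiv:math/0005186 — 5 statements merged into one kernel-verified Lean document; each statement's English description precedes it below -/
import Mathlib

section
/- Let p > 2 be a prime and let K be a field of characteristic zero equipped with an additive valuation v : K → ℤ ∪ {∞} normalized so that v(p) = 1. Let (a_m)_{m≥0} be a sequence in K with v(a_m) ≥ 0 for all m and v(a_m) = 0 for at least one m. Set c_0 := a_0 and c_m := a_m · p^m / m for m ≥ 1, and define I := min{ m ≥ 0 : v(a_m) = 0 } and J := min{ m ≥ 0 : v(c_ℓ) > v(c_m) for all ℓ > m } (this minimum exists). If I < p² − 2 and p divides I + 1, then J ≤ I + 1. -/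
theorem aux_nonneg {K : Type*} [Field K] (v : AddValuation K (WithTop ℤ)) (n : ℕ) :
    0 ≤ v (n : K) := by
  induction n with
  | zero => simp
  | succ k ih =>
    push_cast
    exact le_trans (le_min ih (by simp)) (v.map_add _ _)

theorem aux_unit {K : Type*} [Field K] (v : AddValuation K (WithTop ℤ)) (p : ℕ) (hp : p.Prime)
    (hvp : v (p : K) = 1) (u : ℕ) (hu : ¬ p ∣ u) : v (u : K) = 0 := by
  refine le_antisymm ?_ (aux_nonneg v u)
  by_contra h
  rw [not_le] at h
  have hcop : Nat.Coprime u p := ((Nat.Prime.coprime_iff_not_dvd hp).2 hu).symm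
  obtain ⟨x, hx⟩ := Nat.exists_mul_mod_eq_one_of_coprime hcop hp.one_lt
  have h1 : (u : K) * x = p * ((u * x / p : ℕ) : K) + 1 := by
    have := Nat.div_add_mod (u * x) p
    rw [hx.2] at this
    have h0 := congrArg (Nat.cast : ℕ → K) this.symm
    rwa [Nat.cast_mul, Nat.cast_add, Nat.cast_mul, Nat.cast_one] at h0
  have h2 : (1 : K) = u * x - p * ((u * x / p : ℕ) : K) := by rw [h1]; ring
  have h3 : 0 < v (1 : K) := by
    rw [h2]
    refine lt_of_lt_of_le (lt_min ?_ ?_) (v.map_sub _ _)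
    · rw [v.map_mul]; exact add_pos_of_pos_of_nonneg h (aux_nonneg v _)
    · rw [v.map_mul, hvp]; exact add_pos_of_pos_of_nonneg one_pos (aux_nonneg v _)
  simp at h3

theorem aux_val {K : Type*} [Field K] (v : AddValuation K (WithTop ℤ)) (p : ℕ) (hp : p.Prime)
    (hvp : v (p : K) = 1) (m : ℕ) (hm : 1 ≤ m) :
    ∃ t u : ℕ, m = p ^ t * u ∧ ¬ p ∣ u ∧ v (m : K) = ((t : ℤ) : WithTop ℤ) := by
  obtain ⟨t, u, hu, rfl⟩ := Nat.exists_eq_pow_mul_and_not_dvd (n := m) (by omega) p hp.ne_one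
  refine ⟨t, u, rfl, hu, ?_⟩
  push_cast
  rw [v.map_mul, v.map_pow, hvp, aux_unit v p hp hvp u hu]
  simp

theorem aux_lt (p : ℕ) (hp2 : 2 < p) (I l t u : ℕ)
    (hIb : I < p ^ 2 - 2) (hdvd : p ∣ I + 1) (hl : I + 1 < l) (hlt : l = p ^ t * u)
    (hu : ¬ p ∣ u) : I + 1 + t ≤ l := by
  obtain ⟨k, hk⟩ := hdvd
  by_contra hcon
  have ht : t ≠ 0 := by rintro rfl; omega
  have hpl : p ∣ l := by rw [hlt]; exact Dvd.dvd.mul_right (dvd_pow_self p ht) u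
  have hj : p ∣ l - (I + 1) := Nat.dvd_sub hpl ⟨k, hk⟩
  have hj2 : p ≤ l - (I + 1) := Nat.le_of_dvd (by omega) hj
  have hu0 : 1 ≤ u := by
    rcases Nat.eq_zero_or_pos u with h | h
    · subst h; simp at hu
    · exact h
  obtain ⟨s, rfl⟩ : ∃ s, t = s + 2 := ⟨t - 2, by omega⟩
  have h1 : p ^ (s + 2) ≤ l := by rw [hlt]; exact Nat.le_mul_of_pos_right _ hu0
  have h2 : s + 1 ≤ p ^ s := Nat.lt_pow_self (by omega)
  have h3 : p ^ 2 * (s + 1) ≤ p ^ (s + 2) := by rw [pow_add, mul_comm (p ^ s)]; gcongr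
  have h4 : 9 ≤ p ^ 2 := by nlinarith
  have h5 : p ^ 2 * (s + 1) = p ^ 2 * s + p ^ 2 := by ring
  have h6 : 9 * s ≤ p ^ 2 * s := Nat.mul_le_mul_right _ h4
  omega

/-- Lemma 1.3(a) of Lorenzini–Tucker: if `p ∣ I + 1` then `J ≤ I + 1`. -/
theorem stmt0 (p : ℕ) (hp : p.Prime) (hp2 : 2 < p)
    (K : Type*) [Field K] [CharZero K]
    (v : AddValuation K (WithTop ℤ)) (hvp : v (p : K) = 1)
    (a : ℕ → K) (ha : ∀ m, 0 ≤ v (a m)) (ha0 : ∃ m, v (a m) = 0)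
    (c : ℕ → K) (hc0 : c 0 = a 0)
    (hc : ∀ m, 1 ≤ m → c m = a m * (p : K) ^ m / (m : K))
    (I : ℕ) (hI : I = sInf {m | v (a m) = 0})
    (hIbound : I < p ^ 2 - 2) (hdvd : p ∣ I + 1) :
    {m : ℕ | ∀ ℓ, m < ℓ → v (c m) < v (c ℓ)}.Nonempty ∧
      sInf {m : ℕ | ∀ ℓ, m < ℓ → v (c m) < v (c ℓ)} ≤ I + 1 := by
  have hvI : v (a I) = 0 := by rw [hI]; exact Nat.sInf_mem (s := {m | v (a m) = 0}) ha0
  have key : ∀ m, 1 ≤ m → ∃ t u : ℕ, m = p ^ t * u ∧ ¬ p ∣ u ∧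
      v (c m) + ((t : ℤ) : WithTop ℤ) = v (a m) + ((m : ℤ) : WithTop ℤ) := by
    intro m hm
    obtain ⟨t, u, h1, h2, h3⟩ := aux_val v p hp hvp m hm
    refine ⟨t, u, h1, h2, ?_⟩
    have hm0 : (m : K) ≠ 0 := by exact_mod_cast (by omega : m ≠ 0)
    have h : c m * m = a m * (p : K) ^ m := by rw [hc m hm]; field_simp
    have h' := congrArg v h
    rw [v.map_mul, v.map_mul, v.map_pow, hvp, h3] at h'
    rw [h']
    simp
  have hI1 : 1 ≤ I := by
    have := Nat.le_of_dvd (by omega) hdvd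
    omega
  have hpI : ¬ p ∣ I := fun h => by
    have := (Nat.dvd_add_right h).1 hdvd
    exact hp.one_lt.ne' (Nat.dvd_one.1 this)
  have hcI : v (c I) = ((I : ℤ) : WithTop ℤ) := by
    obtain ⟨t, u, h1, h2, h3⟩ := key I hI1
    have ht : t = 0 := by
      by_contra ht
      exact hpI (h1 ▸ Dvd.dvd.mul_right (dvd_pow_self p ht) u)
    subst ht
    rw [hvI] at h3
    simpa using h3
  have hbig : ∀ l, I + 1 < l → ((I : ℤ) : WithTop ℤ) < v (c l) := by
    intro l hl
    obtain ⟨t, u, h1, h2, h3⟩ := key l (by omega)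
    have h4 := aux_lt p hp2 I l t u hIbound hdvd hl h1 h2
    have h5 := ha l
    generalize v (c l) = x at *
    generalize v (a l) = y at *
    cases x with
    | top => exact WithTop.coe_lt_top _
    | coe x =>
      cases y with
      | top => rw [top_add, ← WithTop.coe_add] at h3; exact absurd h3 (WithTop.coe_ne_top)
      | coe y =>
        norm_cast at h3 h5 ⊢
        push_cast at h3
        omega
  obtain ⟨t, u, h1, h2, h3⟩ := key (I + 1) (by omega)
  have ht : t = 1 := by
    have h4 : t ≠ 0 := by
      rintro rfl
      apply h2
      rw [pow_zero, one_mul] at h1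
      rwa [← h1]
    have hu0 : 1 ≤ u := by
      rcases Nat.eq_zero_or_pos u with h | h
      · subst h; simp at h2
      · exact h
    have h6 : p ^ t ≤ I + 1 := by rw [h1]; exact Nat.le_mul_of_pos_right _ hu0
    by_contra h5
    have h7 : p ^ 2 ≤ p ^ t := Nat.pow_le_pow_right (by omega) (by omega)
    omega
  subst ht
  have hmem : ∃ m ∈ {m : ℕ | ∀ ℓ, m < ℓ → v (c m) < v (c ℓ)}, m ≤ I + 1 := by
    by_cases hz : v (a (I + 1)) = 0
    · refine ⟨I + 1, ?_, le_rfl⟩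
      intro l hl
      have : v (c (I + 1)) = ((I : ℤ) : WithTop ℤ) := by
        rw [hz] at h3
        generalize v (c (I + 1)) = x at *
        cases x with
        | top => rw [top_add, zero_add] at h3; exact absurd h3.symm (WithTop.coe_ne_top)
        | coe x =>
          rw [zero_add, ← WithTop.coe_add, WithTop.coe_inj] at h3
          rw [WithTop.coe_inj]
          push_cast at h3
          omega
      rw [this]
      exact hbig l hl
    · refine ⟨I, ?_, by omega⟩
      intro l hl
      rw [hcI]
      rcases Nat.lt_or_ge (I + 1) l with h | h
      · exact hbig l h
      · obtain rfl : l = I + 1 := by omega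
        have h5 := lt_of_le_of_ne (ha (I + 1)) (Ne.symm hz)
        generalize v (c (I + 1)) = x at *
        generalize v (a (I + 1)) = y at *
        cases x with
        | top => exact WithTop.coe_lt_top _
        | coe x =>
          cases y with
          | top => rw [top_add, ← WithTop.coe_add] at h3; exact absurd h3 (WithTop.coe_ne_top)
          | coe y =>
            rw [← WithTop.coe_add, ← WithTop.coe_add, WithTop.coe_inj] at h3
            rw [← WithTop.coe_zero, WithTop.coe_lt_coe] at h5
            rw [WithTop.coe_lt_coe]
            push_cast at h3
            omega
  obtain ⟨m, hm, hle⟩ := hmem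
  exact ⟨⟨m, hm⟩, (Nat.sInf_le hm).trans hle⟩
end

section
/- Let p > 2 be a prime and let (a_m)_{m≥0} be a sequence in ℤ_p such that a_m is a unit of ℤ_p for at least one m. Let I := min{ m : a_m is a unit } and assume I < p² − 2. Then for every z ∈ ℤ_p the series Σ_{m≥1} (a_m p^m / m) z^m converges in ℚ_p, and the set { z ∈ ℤ_p : a_0 + Σ_{m≥1} (a_m p^m / m) z^m = 0 } is finite of cardinality at most I + 1; if moreover p does not divide I + 1, its cardinality is at most I. -/
lemma strassman_aux (p : ℕ) [Fact p.Prime] (C : ℝ) (hC : 0 ≤ C) (M : ℕ) :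
    ∀ (c : ℕ → ℚ_[p]), Filter.Tendsto c Filter.atTop (nhds 0) →
      (∃ i ≤ M, C < ‖c i‖) → (∀ n, M < n → ‖c n‖ ≤ C) →
      ∃ T : Finset ℤ_[p], T.card ≤ M ∧ ∀ z : ℤ_[p],
        ∑' n : ℕ, c n * (z : ℚ_[p]) ^ n = 0 → z ∈ T := by
  have hsum : ∀ (c : ℕ → ℚ_[p]), Filter.Tendsto c Filter.atTop (nhds 0) → ∀ z : ℤ_[p],
      Summable (fun n => c n * (z : ℚ_[p]) ^ n) := by
    intro c hc z
    apply NonarchimedeanAddGroup.summable_of_tendsto_cofinite_zero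
    rw [Nat.cofinite_eq_atTop]
    refine squeeze_zero_norm (a := fun n => ‖c n‖) (fun n => ?_) (by simpa using hc.norm)
    rw [norm_mul, norm_pow]
    exact mul_le_of_le_one_right (norm_nonneg _) (pow_le_one₀ (norm_nonneg _) z.2)
  have hle : ∀ (c : ℕ → ℚ_[p]) (D : ℝ), 0 ≤ D → (∀ n, ‖c n‖ ≤ D) → ∀ z : ℤ_[p],
      ‖∑' n, c n * (z : ℚ_[p]) ^ n‖ ≤ D := by
    intro c D hD h z
    apply IsUltrametricDist.norm_tsum_le_of_forall_le_of_nonneg hD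
    intro n
    rw [norm_mul, norm_pow]
    exact (mul_le_of_le_one_right (norm_nonneg _) (pow_le_one₀ (norm_nonneg _) z.2)).trans (h n)
  have hshift : ∀ (c : ℕ → ℚ_[p]), Filter.Tendsto c Filter.atTop (nhds 0) → ∀ z : ℤ_[p],
      ∑' n, c n * (z : ℚ_[p]) ^ n = c 0 + z * ∑' n, c (n+1) * (z : ℚ_[p]) ^ n := by
    intro c hc z
    rw [(hsum c hc z).tsum_eq_zero_add, ← tsum_mul_left]
    simp only [pow_zero, mul_one]
    congr 1
    apply tsum_congr
    intro n; ring
  have hz : ∀ (z : ℤ_[p]) (x : ℚ_[p]), ‖x‖ ≤ C → ‖(z : ℚ_[p]) * x‖ ≤ C := by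
    intro z x hx
    rw [norm_mul]
    exact (mul_le_of_le_one_left (norm_nonneg _) z.2).trans hx
  induction M with
  | zero =>
    intro c hc ⟨i, hi, hci⟩ hn
    refine ⟨∅, by simp, fun z h => ?_⟩
    exfalso
    obtain rfl : i = 0 := by omega
    rw [hshift c hc z] at h
    have h1 := hle (fun n => c (n+1)) C hC (fun n => hn _ (by omega)) z
    have h2 := hz z _ h1
    rw [eq_neg_of_add_eq_zero_left h, norm_neg] at hci
    linarith
  | succ M ih =>
    intro c hc ⟨i, hi, hci⟩ hn
    by_cases hex : ∃ α : ℤ_[p], ∑' n : ℕ, c n * (α : ℚ_[p]) ^ n = 0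
    swap
    · push Not at hex
      exact ⟨∅, by simp, fun z h => absurd h (hex z)⟩
    obtain ⟨α, hα⟩ := hex
    have hcs : ∀ j, Filter.Tendsto (fun n => c (n + j)) Filter.atTop (nhds 0) := fun j =>
      (Filter.tendsto_add_atTop_iff_nat j).2 hc
    set b : ℕ → ℚ_[p] := fun j => ∑' n, c (n + (j + 1)) * (α : ℚ_[p]) ^ n with hb
    have hrec : ∀ j, b j = c (j+1) + α * b (j+1) := by
      intro j
      have := hshift _ (hcs (j+1)) α
      simp only [hb]
      rw [this]
      simp only [Nat.zero_add]
      congr 3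
      ext n
      congr 2
      ring
    have h0 : c 0 + α * b 0 = 0 := by
      rw [← hα, hshift c hc α]
    have hbt : Filter.Tendsto b Filter.atTop (nhds 0) := by
      rw [Metric.tendsto_atTop] at hc ⊢
      intro ε hε
      obtain ⟨N, hN⟩ := hc (ε/2) (by positivity)
      refine ⟨N, fun n hn => ?_⟩
      rw [dist_zero_right]
      refine lt_of_le_of_lt (hle _ (ε/2) (by positivity) (fun k => ?_) α) (half_lt_self hε)
      have := hN (k + (n+1)) (by omega)
      rw [dist_zero_right] at this
      exact this.le
    have hbn : ∀ n, M < n → ‖b n‖ ≤ C := fun n hMn =>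
      hle _ C hC (fun k => hn _ (by omega)) α
    have hbi : ∃ i ≤ M, C < ‖b i‖ := by
      by_contra hcon
      push Not at hcon
      have hall : ∀ n, ‖b n‖ ≤ C := fun n => by
        rcases le_or_gt n M with h | h
        · exact hcon n h
        · exact hbn n h
      rcases i with _ | j
      · rw [eq_neg_of_add_eq_zero_left h0, norm_neg] at hci
        linarith [hz α _ (hall 0)]
      · have e : c (j+1) = b j - α * b (j+1) := by rw [hrec j]; ring
        rw [e] at hci
        have := (Padic.nonarchimedean (b j) (-(α * b (j+1)))).trans
          (max_le (hall j) (by rw [norm_neg]; exact hz α _ (hall _)))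
        rw [← sub_eq_add_neg] at this
        linarith
    obtain ⟨T, hT, hTz⟩ := ih b hbt hbi hbn
    classical
    refine ⟨insert α T, (Finset.card_insert_le _ _).trans (by omega), fun z hzz => ?_⟩
    by_cases hza : z = α
    · simp [hza]
    refine Finset.mem_insert_of_mem (hTz z ?_)
    have hne : (z : ℚ_[p]) - α ≠ 0 := by
      rw [sub_ne_zero]; exact fun h => hza (Subtype.ext h)
    have key : ((z : ℚ_[p]) - α) * ∑' n, b n * (z : ℚ_[p]) ^ n = 0 := by
      have e1 := hshift b hbt z
      have e2 := hshift c hc z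
      have s1 := hsum _ (hcs 1) z
      have hbt1 : Filter.Tendsto (fun n => b (n+1)) Filter.atTop (nhds 0) :=
        (Filter.tendsto_add_atTop_iff_nat 1).2 hbt
      have s2 := (hsum _ hbt1 z).mul_left (α : ℚ_[p])
      have e3 : ∑' n, b n * (z : ℚ_[p]) ^ n = ∑' n, c (n+1) * (z : ℚ_[p]) ^ n
          + α * ∑' n, b (n+1) * (z : ℚ_[p]) ^ n := by
        rw [← tsum_mul_left, ← s1.tsum_add s2]
        apply tsum_congr
        intro n
        rw [hrec n]; ring
      rw [hzz] at e2
      linear_combination (z : ℚ_[p]) * e3 - α * e1 - e2 - h0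
    exact (mul_eq_zero.1 key).resolve_left hne

lemma norm_natCast_inv_le_aux (p : ℕ) [Fact p.Prime] (n : ℕ) (hn : n ≠ 0) :
    ‖(n : ℚ_[p])‖⁻¹ ≤ n := by
  have h0 : (n : ℚ_[p]) ≠ 0 := by exact_mod_cast hn
  rw [Padic.norm_eq_zpow_neg_valuation h0, Padic.valuation_natCast, zpow_neg, inv_inv,
    zpow_natCast]
  exact_mod_cast Nat.le_of_dvd (Nat.pos_of_ne_zero hn) pow_padicValNat_dvd

lemma coeff_bound_aux (p : ℕ) [Fact p.Prime] (I n : ℕ) (hn : I < n)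
    (h : ¬ p ^ (n - I) ∣ n) :
    ‖(p : ℚ_[p]) ^ n / (n : ℚ_[p])‖ ≤ (p : ℝ) ^ (-(I + 1 : ℕ) : ℤ) := by
  have hp1 : (1 : ℝ) < p := by exact_mod_cast (Fact.out : p.Prime).one_lt
  have hn0 : n ≠ 0 := by omega
  have h0 : (n : ℚ_[p]) ≠ 0 := by exact_mod_cast hn0
  rw [norm_div, Padic.norm_p_pow, Padic.norm_eq_zpow_neg_valuation h0, Padic.valuation_natCast,
    ← zpow_sub₀ (by positivity)]
  apply zpow_le_zpow_right₀ hp1.le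
  rw [padicValNat_dvd_iff_le hn0] at h
  omega

set_option maxHeartbeats 2000000 in
/-- Zeros of the Coleman power series `λ(z) = a₀ + Σ_{m≥1} (a_m p^m / m) z^m` on `ℤ_p`:
there are at most `I + 1` of them, and at most `I` when `p ∤ I + 1`. -/
theorem stmt2 (p : ℕ) [Fact p.Prime] (hp2 : 2 < p)
    (a : ℕ → ℤ_[p]) (ha : ∃ m, IsUnit (a m))
    (I : ℕ) (hI : I = sInf {m | IsUnit (a m)}) (hIbound : I < p ^ 2 - 2)
    (S : Set ℤ_[p])
    (hS : S = {z : ℤ_[p] | (a 0 : ℚ_[p]) + ∑' m : ℕ,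
        (a (m + 1) : ℚ_[p]) * (p : ℚ_[p]) ^ (m + 1) / ((m : ℚ_[p]) + 1)
          * (z : ℚ_[p]) ^ (m + 1) = 0}) :
    (∀ z : ℤ_[p], Summable (fun m : ℕ =>
        (a (m + 1) : ℚ_[p]) * (p : ℚ_[p]) ^ (m + 1) / ((m : ℚ_[p]) + 1)
          * (z : ℚ_[p]) ^ (m + 1))) ∧
    S.Finite ∧ S.ncard ≤ I + 1 ∧ (¬ p ∣ I + 1 → S.ncard ≤ I) := by
  have hp1 : (1 : ℝ) < p := by exact_mod_cast (Fact.out : p.Prime).one_lt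
  have hunit : IsUnit (a I) := by
    have : sInf {m | IsUnit (a m)} ∈ {m | IsUnit (a m)} := Nat.sInf_mem ha
    rw [← hI] at this
    exact this
  set c : ℕ → ℚ_[p] := fun n =>
    if n = 0 then (a 0 : ℚ_[p]) else (a n : ℚ_[p]) * ((p : ℚ_[p]) ^ n / (n : ℚ_[p])) with hcdef
  have hc0 : c 0 = a 0 := by simp [hcdef]
  have hcs : ∀ m z, (a (m + 1) : ℚ_[p]) * (p : ℚ_[p]) ^ (m + 1) / ((m : ℚ_[p]) + 1) * z
      = c (m+1) * z := by
    intro m z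
    simp only [hcdef, Nat.succ_ne_zero, if_false]
    push_cast
    ring
  have hcn : ∀ n, n ≠ 0 → ‖c n‖ ≤ ‖(p : ℚ_[p]) ^ n / (n : ℚ_[p])‖ := by
    intro n hn
    simp only [hcdef, hn, if_false]
    rw [norm_mul]
    exact mul_le_of_le_one_left (norm_nonneg _) (a n).2
  have hct : Filter.Tendsto c Filter.atTop (nhds 0) := by
    have ht := tendsto_self_mul_const_pow_of_lt_one (r := (p : ℝ)⁻¹) (by positivity)
      (inv_lt_one_of_one_lt₀ hp1)
    refine squeeze_zero_norm' ?_ ht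
    filter_upwards [Filter.eventually_ne_atTop 0] with n hn
    refine (hcn n hn).trans ?_
    rw [norm_div, norm_pow, Padic.norm_p, div_eq_mul_inv, mul_comm]
    exact mul_le_mul_of_nonneg_right (norm_natCast_inv_le_aux p n hn) (by positivity)
  have hsum : ∀ z : ℤ_[p], Summable (fun n : ℕ => c n * (z : ℚ_[p]) ^ n) := by
    intro z
    apply NonarchimedeanAddGroup.summable_of_tendsto_cofinite_zero
    rw [Nat.cofinite_eq_atTop]
    refine squeeze_zero_norm (a := fun n => ‖c n‖) (fun n => ?_) (by simpa using hct.norm)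
    rw [norm_mul, norm_pow]
    exact mul_le_of_le_one_right (norm_nonneg _) (pow_le_one₀ (norm_nonneg _) z.2)
  simp only [hcs] at hS ⊢
  refine ⟨fun z => (summable_nat_add_iff 1).2 (hsum z), ?_⟩
  have hS' : ∀ z ∈ S, ∑' n, c n * (z : ℚ_[p]) ^ n = 0 := by
    intro z hz
    rw [hS] at hz
    rw [(hsum z).tsum_eq_zero_add]
    simpa [hc0] using hz
  have hbig : (p : ℝ) ^ (-(I + 1 : ℕ) : ℤ) < ‖c I‖ := by
    have hlt : (p : ℝ) ^ (-(I + 1 : ℕ) : ℤ) < (p : ℝ) ^ (-(I : ℕ) : ℤ) :=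
      zpow_lt_zpow_right₀ hp1 (by push_cast; omega)
    refine hlt.trans_le ?_
    have hu : ‖(a I : ℚ_[p])‖ = 1 := by
      rw [← PadicInt.norm_def]; exact PadicInt.isUnit_iff.1 hunit
    by_cases h : I = 0
    · subst h
      rw [hc0, hu]; simp
    · simp only [hcdef, h, if_false]
      rw [norm_mul, hu, one_mul, norm_div, Padic.norm_p_pow]
      have hle1 : ‖(I : ℚ_[p])‖ ≤ 1 := by
        simpa using Padic.norm_int_le_one (p := p) (I : ℤ)
      have hpos : 0 < ‖(I : ℚ_[p])‖ := norm_pos_iff.2 (by exact_mod_cast h)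
      exact le_div_self (by positivity) hpos hle1
  have hsmall : ∀ n, I + 1 < n → ‖c n‖ ≤ (p : ℝ) ^ (-(I + 1 : ℕ) : ℤ) := by
    intro n hn
    refine (hcn n (by omega)).trans (coeff_bound_aux p I n (by omega) fun hd => ?_)
    obtain ⟨k, rfl⟩ : ∃ k, n = I + 2 + k := ⟨n - (I + 2), by omega⟩
    have h1 := Nat.le_of_dvd (by omega) hd
    have e : I + 2 + k - I = k + 2 := by omega
    rw [e, pow_add] at h1
    have h2 : k < p ^ k := Nat.lt_pow_self (by omega)
    have h3 : (k + 1) * p ^ 2 ≤ p ^ k * p ^ 2 := Nat.mul_le_mul_right _ h2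
    have h4 : I + 2 < p ^ 2 := by omega
    nlinarith
  have hfin : ∀ T : Finset ℤ_[p], (∀ z : ℤ_[p], ∑' n : ℕ, c n * (z : ℚ_[p]) ^ n = 0 → z ∈ T) →
      S.Finite ∧ S.ncard ≤ T.card := by
    intro T hT
    have hsub : S ⊆ (T : Set ℤ_[p]) := fun z hz => hT z (hS' z hz)
    refine ⟨T.finite_toSet.subset hsub, ?_⟩
    rw [← Set.ncard_coe_finset]
    exact Set.ncard_le_ncard hsub T.finite_toSet
  obtain ⟨T, hTc, hT⟩ := strassman_aux p _ (by positivity) (I + 1) c hct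
    ⟨I, by omega, hbig⟩ hsmall
  refine ⟨(hfin T hT).1, (hfin T hT).2.trans hTc, fun hnd => ?_⟩
  obtain ⟨T, hTc, hT⟩ := strassman_aux p _ (by positivity) I c hct
    ⟨I, le_rfl, hbig⟩ (fun n hn => by
      rcases Nat.lt_or_ge (I + 1) n with h | h
      · exact hsmall n h
      · obtain rfl : n = I + 1 := by omega
        exact (hcn _ (by omega)).trans (coeff_bound_aux p I _ (by omega) (by simpa using hnd)))
  exact (hfin T hT).2.trans hTc
end

section
/- Let p ≥ 3 be a prime, let U be a finite set, let Z : U → ℕ be a function, and let N be a natural number with Σ_{Q ∈ U} Z(Q) ≤ N. Then Σ_{Q ∈ U, p ∣ Z(Q)+2} (Z(Q) + 2) + Σ_{Q ∈ U, p ∤ Z(Q)+2} (Z(Q) + 1) ≤ |U| + ((p − 1)/(p − 2)) · N, the inequality being an inequality of rational numbers. -/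
/-- The counting argument in Proposition 1.4 of Lorenzini–Tucker. -/
theorem stmt4 {α : Type*} (p : ℕ) (hp : p.Prime) (hp3 : 3 ≤ p)
    (U : Finset α) (Z : α → ℕ) (N : ℕ) (hZ : ∑ Q ∈ U, Z Q ≤ N) :
    (∑ Q ∈ U.filter (fun Q => p ∣ Z Q + 2), ((Z Q : ℚ) + 2)) +
      (∑ Q ∈ U.filter (fun Q => ¬ p ∣ Z Q + 2), ((Z Q : ℚ) + 1)) ≤
      (U.card : ℚ) + ((p : ℚ) - 1) / ((p : ℚ) - 2) * (N : ℚ) := by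
  have h2 : (0 : ℚ) < (p : ℚ) - 2 := by
    have : (3 : ℚ) ≤ p := by exact_mod_cast hp3
    linarith
  have hc : ((p : ℚ) - 1) / ((p : ℚ) - 2) = 1 + 1 / ((p : ℚ) - 2) := by
    field_simp
    ring
  have hcpos : (0 : ℚ) ≤ 1 / ((p : ℚ) - 2) := by positivity
  have hN : (∑ Q ∈ U, (Z Q : ℚ)) ≤ N := by exact_mod_cast hZ
  rw [← Finset.sum_ite]
  calc (∑ Q ∈ U, if p ∣ Z Q + 2 then (Z Q : ℚ) + 2 else (Z Q : ℚ) + 1)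
      ≤ ∑ Q ∈ U, (1 + (1 + 1 / ((p : ℚ) - 2)) * (Z Q : ℚ)) := by
        apply Finset.sum_le_sum
        intro Q _
        have hz : (0 : ℚ) ≤ Z Q := Nat.cast_nonneg _
        split_ifs with h
        · have hle : p ≤ Z Q + 2 := Nat.le_of_dvd (by omega) h
          have hle' : (p : ℚ) ≤ Z Q + 2 := by exact_mod_cast hle
          have : 1 ≤ 1 / ((p : ℚ) - 2) * (Z Q : ℚ) := by
            rw [one_div_mul_eq_div, le_div_iff₀ h2]
            linarith
          linarith
        · have := mul_nonneg hcpos hz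
          linarith
    _ = (U.card : ℚ) + (1 + 1 / ((p : ℚ) - 2)) * ∑ Q ∈ U, (Z Q : ℚ) := by
        rw [Finset.sum_add_distrib, ← Finset.mul_sum]
        simp
    _ ≤ _ := by
        rw [hc]
        gcongr
end

section
/- Let k be an algebraically closed field, let n ≥ 1 be an integer with char(k) ∤ n, let f ∈ k[x, y] be a homogeneous polynomial of degree n, and let μ ∈ k with μ ≠ 0. Then the polynomial f(x, y) − μ z^n is reducible in k[x, y, z] if and only if there exist a proper divisor d of n (d ∣ n, d < n) and g ∈ k[x, y] with f = g^{n/d}. Moreover, if d ∣ n, g ∈ k[x, y] satisfies f = g^{n/d}, ν ∈ k satisfies ν^{n/d} = μ, and ξ ∈ k is a primitive n-th root of unity, then f − μ z^n = ∏_{i=1}^{n/d} (g − ξ^{i d} ν z^d). -/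
open MvPolynomial

lemma aux_root_of_unity {k K : Type*} [Field k] [IsAlgClosed k] [Field K] [Algebra k K]
    {e : ℕ} (he : 0 < e) {z : K} (hz : z ^ e = 1) : ∃ w : k, algebraMap k K w = z := by
  have hint : IsIntegral k z := IsIntegral.of_pow he (by rw [hz]; exact isIntegral_one)
  exact minpoly.mem_range_of_degree_eq_one k z
    (IsAlgClosed.degree_eq_one_of_irreducible k (minpoly.irreducible hint))

lemma aux_field {k K : Type*} [Field k] [IsAlgClosed k] [Field K] [Algebra k K]
    {n : ℕ} (hn : 0 < n) (a : K)
    (h : ¬ Irreducible (Polynomial.X ^ n - Polynomial.C a : Polynomial K)) :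
    ∃ m : ℕ, m ∣ n ∧ m ≠ 1 ∧ ∃ b : K, b ^ m = a := by
  by_cases ha : a = 0
  · refine ⟨n, dvd_rfl, ?_, 0, by rw [ha, zero_pow hn.ne']⟩
    rintro rfl
    exact h (by simpa using Polynomial.irreducible_X_sub_C a)
  have hu : ¬ IsUnit (Polynomial.X ^ n - Polynomial.C a : Polynomial K) := by
    rw [Polynomial.isUnit_iff_degree_eq_zero, Polynomial.degree_X_pow_sub_C hn, Nat.cast_eq_zero]
    exact hn.ne'
  have hne := Polynomial.X_pow_sub_C_ne_zero hn a
  have ⟨g, hg, hg'⟩ := WfDvdMonoid.exists_irreducible_factor hu hne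
  have hle : g.natDegree ≤ n :=
    (Polynomial.natDegree_le_of_dvd hg' hne).trans_eq Polynomial.natDegree_X_pow_sub_C
  have hlt : g.natDegree < n := by
    refine lt_of_le_of_ne hle fun this => h ?_
    exact (Polynomial.associated_of_dvd_of_natDegree_le hg' hne
      (this.trans Polynomial.natDegree_X_pow_sub_C.symm).ge).irreducible hg
  have hpos : 0 < g.natDegree :=
    Polynomial.natDegree_pos_iff_degree_pos.mpr (Polynomial.degree_pos_of_irreducible hg)
  have key : (Algebra.norm K (AdjoinRoot.root g)) ^ n = a ^ g.natDegree := by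
    have := Polynomial.eval₂_eq_zero_of_dvd_of_eval₂_eq_zero _ _ hg' (AdjoinRoot.eval₂_root g)
    rw [Polynomial.eval₂_sub, Polynomial.eval₂_pow, Polynomial.eval₂_C, Polynomial.eval₂_X,
      sub_eq_zero] at this
    rw [← map_pow, this, ← AdjoinRoot.algebraMap_eq, Algebra.norm_algebraMap,
      (AdjoinRoot.powerBasis hg.ne_zero).finrank, AdjoinRoot.powerBasis_dim hg.ne_zero]
  generalize Algebra.norm K (AdjoinRoot.root g) = c at key
  generalize g.natDegree = m at *
  obtain ⟨e, m', n', he, hco, hm, hn'⟩ := Nat.exists_coprime' (Nat.gcd_pos_of_pos_left n hpos)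
  subst hm hn'
  have hn'0 : n' ≠ 0 := by rintro rfl; simp at hn
  have hm0 : m' ≠ 0 := by rintro rfl; simp at hpos
  have ham : a ^ m' ≠ 0 := pow_ne_zero _ ha
  have hz : (c ^ n' / a ^ m') ^ e = 1 := by
    rw [div_pow, ← pow_mul, ← pow_mul, key, pow_mul]
    exact div_self (pow_ne_zero _ ham)
  obtain ⟨w, hw⟩ := aux_root_of_unity (k := k) he hz
  obtain ⟨t, ht⟩ := IsAlgClosed.exists_pow_nat_eq w (Nat.pos_of_ne_zero hn'0)
  have hw0 : algebraMap k K w ≠ 0 := by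
    rw [hw]; intro h0; rw [h0, zero_pow he.ne'] at hz; exact zero_ne_one hz
  have hc : (c / algebraMap k K t) ^ n' = a ^ m' := by
    rw [div_pow, ← map_pow, ht, div_eq_iff hw0, hw]
    field_simp
  refine ⟨n', dvd_mul_right _ _, ?_, ?_⟩
  · rintro rfl
    have : e ≤ m' * e := Nat.le_mul_of_pos_left _ (Nat.pos_of_ne_zero hm0)
    omega
  · exact (pow_mem_range_pow_of_coprime hco a).mp ⟨_, hc⟩

noncomputable def auxEquiv (k : Type*) [Field k] :
    MvPolynomial (Fin 3) k ≃ₐ[k] Polynomial (MvPolynomial (Fin 2) k) :=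
  (renameEquiv k (finSuccEquivLast (n := 2))).trans (optionEquivLeft k (Fin 2))

lemma auxEquiv_X (k : Type*) [Field k] : auxEquiv k (X 2) = Polynomial.X := by
  have : finSuccEquivLast (2 : Fin 3) = none := finSuccEquivLast_last (n := 2)
  simp [auxEquiv, this]

lemma auxEquiv_rename (k : Type*) [Field k] (f : MvPolynomial (Fin 2) k) :
    auxEquiv k (rename Fin.castSucc f) = Polynomial.C f := by
  induction f using MvPolynomial.induction_on with
  | C a => simp [auxEquiv]
  | add p q hp hq => simp [hp, hq]
  | mul_X p i hp =>
    rw [map_mul, map_mul, hp, map_mul]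
    congr 1
    simp [auxEquiv]

lemma auxEquiv_C (k : Type*) [Field k] (c : k) :
    auxEquiv k (C c) = Polynomial.C (C c) := by
  simp [auxEquiv]

lemma aux_irred {k : Type*} [Field k] (n : ℕ) (hn : 1 ≤ n)
    (f : MvPolynomial (Fin 2) k) (μ : k) (hμ : μ ≠ 0) :
    Irreducible (rename Fin.castSucc f - C μ * X (2 : Fin 3) ^ n) ↔
    Irreducible (Polynomial.X ^ n - Polynomial.C
      (algebraMap (MvPolynomial (Fin 2) k) (FractionRing (MvPolynomial (Fin 2) k)) (C μ⁻¹ * f))) := by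
  have hmon : (Polynomial.X ^ n - Polynomial.C (C μ⁻¹ * f) :
    Polynomial (MvPolynomial (Fin 2) k)).Monic := Polynomial.monic_X_pow_sub_C _ (by omega)
  have h1 := hmon.irreducible_iff_irreducible_map_fraction_map
    (K := FractionRing (MvPolynomial (Fin 2) k))
  rw [Polynomial.map_sub, Polynomial.map_pow, Polynomial.map_X, Polynomial.map_C] at h1
  rw [← h1, ← MulEquiv.irreducible_iff (auxEquiv k)]
  apply Associated.irreducible_iff
  have hu : IsUnit (Polynomial.C (C (-μ⁻¹)) : Polynomial (MvPolynomial (Fin 2) k)) :=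
    ((IsUnit.mk0 _ (neg_ne_zero.mpr (inv_ne_zero hμ))).map C).map Polynomial.C
  refine ⟨hu.unit, ?_⟩
  have hC : (C μ * C μ⁻¹ : MvPolynomial (Fin 2) k) = 1 := by
    rw [← C_mul, mul_inv_cancel₀ hμ, C_1]
  have hC' : (Polynomial.C (C μ) * Polynomial.C (C μ⁻¹) :
      Polynomial (MvPolynomial (Fin 2) k)) = 1 := by
    rw [← Polynomial.C_mul, hC, Polynomial.C_1]
  simp only [map_sub, map_mul, map_pow, auxEquiv_X, auxEquiv_rename, auxEquiv_C, IsUnit.unit_spec,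
    map_neg]
  linear_combination (Polynomial.X ^ n) * hC'

lemma aux_prod {R : Type*} [CommRing R] [IsDomain R] {m : ℕ} (hm : 0 < m) {η : R}
    (h : IsPrimitiveRoot η m) (x y : R) :
    x ^ m - y ^ m = ∏ i ∈ Finset.range m, (x - η ^ (i + 1) * y) := by
  haveI : NeZero m := ⟨hm.ne'⟩
  rw [h.pow_sub_pow_eq_prod_sub_mul x y hm]
  symm
  refine Finset.prod_bij (fun i _ => η ^ (i + 1)) ?_ ?_ ?_ ?_
  · intro i _
    rw [Polynomial.mem_nthRootsFinset hm, ← pow_mul, mul_comm, pow_mul, h.pow_eq_one, one_pow]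
  · intro i hi j hj hij
    simp only [pow_succ] at hij
    exact h.pow_inj (Finset.mem_range.mp hi) (Finset.mem_range.mp hj)
      (mul_right_cancel₀ (h.ne_zero hm.ne') hij)
  · intro z hz
    rw [Polynomial.mem_nthRootsFinset hm] at hz
    have : (z * η ^ (m - 1)) ^ m = 1 := by
      rw [mul_pow, hz, ← pow_mul, mul_comm (m - 1), pow_mul, h.pow_eq_one, one_pow, one_mul]
    obtain ⟨j, hj, hj'⟩ := h.eq_pow_of_pow_eq_one this
    refine ⟨j, Finset.mem_range.mpr hj, ?_⟩
    rw [pow_succ, hj', mul_assoc, ← pow_succ, Nat.sub_add_cancel hm, h.pow_eq_one, mul_one]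
  · intros; rfl

/-- Lemma 2.9 of Lorenzini–Tucker: factorization of `f(x,y) - μ zⁿ` over an algebraically
closed field `k` with `char k ∤ n`. -/
theorem stmt6 (k : Type*) [Field k] [IsAlgClosed k]
    (n : ℕ) (hn : 1 ≤ n) (hchar : ¬ (ringChar k ∣ n))
    (f : MvPolynomial (Fin 2) k) (hf : f.IsHomogeneous n)
    (μ : k) (hμ : μ ≠ 0) :
    (¬ Irreducible (rename Fin.castSucc f - C μ * X (2 : Fin 3) ^ n) ↔
      ∃ (d : ℕ) (g : MvPolynomial (Fin 2) k), d ∣ n ∧ d < n ∧ f = g ^ (n / d)) ∧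
    (∀ (d : ℕ) (g : MvPolynomial (Fin 2) k) (ν ξ : k),
      d ∣ n → f = g ^ (n / d) → ν ^ (n / d) = μ → IsPrimitiveRoot ξ n →
      rename Fin.castSucc f - C μ * X (2 : Fin 3) ^ n =
        ∏ i ∈ Finset.range (n / d),
          (rename Fin.castSucc g - C (ξ ^ ((i + 1) * d) * ν) * X (2 : Fin 3) ^ d)) := by
  refine ⟨⟨fun h => ?_, ?_⟩, ?_⟩
  · rw [aux_irred n hn f μ hμ] at h
    obtain ⟨m, ⟨d, rfl⟩, hm1, b, hb⟩ := aux_field (k := k) hn _ h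
    have hm : 0 < m := Nat.pos_of_mul_pos_right hn
    have hd : 0 < d := Nat.pos_of_mul_pos_left hn
    obtain ⟨g, rfl⟩ := IsIntegrallyClosed.exists_algebraMap_eq_of_isIntegral_pow
      (R := MvPolynomial (Fin 2) k) hm (by rw [hb]; exact isIntegral_algebraMap)
    rw [← map_pow] at hb
    have hb' := IsFractionRing.injective _ _ hb
    obtain ⟨t, ht⟩ := IsAlgClosed.exists_pow_nat_eq μ hm
    refine ⟨d, C t * g, dvd_mul_left _ _, ?_, ?_⟩
    · have : 2 ≤ m := by omega
      nlinarith
    · rw [Nat.mul_div_cancel _ hd, mul_pow, hb', ← C_pow, ht, ← mul_assoc, ← C_mul,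
        mul_inv_cancel₀ hμ, C_1, one_mul]
  · rintro ⟨d, g, ⟨m, rfl⟩, hlt, hfg⟩ hirr
    rw [aux_irred _ hn f μ hμ] at hirr
    have hd : 0 < d := Nat.pos_of_mul_pos_right hn
    have hm : 0 < m := Nat.pos_of_mul_pos_left hn
    rw [Nat.mul_div_cancel_left _ hd] at hfg
    obtain ⟨t, ht⟩ := IsAlgClosed.exists_pow_nat_eq μ⁻¹ hm
    refine pow_ne_of_irreducible_X_pow_sub_C hirr (dvd_mul_left m d) ?_
      (algebraMap _ _ (C t * g)) ?_
    · rintro rfl; omega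
    · rw [← map_pow, mul_pow, ← C_pow, ht, hfg]
  · rintro d g ν ξ ⟨m, rfl⟩ hfg hν hξ
    have hd : 0 < d := Nat.pos_of_mul_pos_right hn
    have hm : 0 < m := Nat.pos_of_mul_pos_left hn
    rw [Nat.mul_div_cancel_left _ hd] at *
    have h1 : IsPrimitiveRoot (ξ ^ d) m := hξ.pow hn rfl
    have h2 : IsPrimitiveRoot (C (ξ ^ d) : MvPolynomial (Fin 3) k) m :=
      h1.map_of_injective (f := (C : k →+* MvPolynomial (Fin 3) k)) (C_injective _ _)
    have := aux_prod hm h2 (rename Fin.castSucc g) (C ν * X (2 : Fin 3) ^ d)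
    rw [mul_pow, ← C_pow, hν, ← pow_mul, ← map_pow, ← hfg] at this
    rw [this]
    refine Finset.prod_congr rfl fun i _ => ?_
    rw [← C_pow, ← pow_mul, C_mul, mul_comm d, mul_assoc]
end

section
/- Let L be a field with an additive valuation v : L → ℤ ∪ {∞}, and let O_L = { x ∈ L : v(x) ≥ 0 } be its valuation ring. Let n ≥ 1, let α_1, …, α_n ∈ O_L (listed with multiplicity), and let h ∈ O_L with v(h) > 0. Let (a, b) and (a', b') be pairs of elements of O_L with min(v(a), v(b)) = 0 and min(v(a'), v(b')) = 0, satisfying ∏_{j=1}^n (a − α_j b) = h and ∏_{j=1}^n (a' − α_j b') = h. Suppose i is an index such that v(a − α_i b) = max_j v(a − α_j b) and v(a' − α_i b') = max_j v(a' − α_j b'). Then v(a − α_i b) = v(a' − α_i b'). -/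
theorem aux_key {L : Type*} [Field L] (v : AddValuation L (WithTop ℤ))
    (n : ℕ) (α : Fin n → L) (hα : ∀ j, 0 ≤ v (α j))
    (h : L) (hh : 0 < v h) (a b : L)
    (hab : min (v a) (v b) = 0)
    (heq : ∏ j, (a - α j * b) = h) (i : Fin n)
    (hi : ∀ j, v (a - α j * b) ≤ v (a - α i * b)) (j : Fin n) :
    v (a - α j * b) = min (v (a - α i * b)) (v (α i - α j)) := by
  have hpos : 0 < v (a - α i * b) := by
    by_contra hc
    have hc := not_lt.mp hc
    have : ∀ s : Finset (Fin n), v (∏ j ∈ s, (a - α j * b)) ≤ 0 := by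
      intro s
      induction s using Finset.induction_on with
      | empty => simp
      | insert k s hk ih =>
        rw [Finset.prod_insert hk, v.map_mul]
        exact add_nonpos ((hi k).trans hc) ih
    have h1 := this Finset.univ
    rw [heq] at h1
    exact absurd hh (not_lt.mpr h1)
  have ha0 : 0 ≤ v a := hab ▸ min_le_left _ _
  have hb0 : 0 ≤ v b := hab ▸ min_le_right _ _
  have hb : v b = 0 := by
    by_contra hne
    have hbpos : 0 < v b := lt_of_le_of_ne hb0 (Ne.symm hne)
    have h1 : 0 < v (α i * b) := by
      rw [v.map_mul]
      exact lt_of_lt_of_le hbpos (le_add_of_nonneg_left (hα i))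
    have h2 : 0 < v a := by
      have h3 := v.map_add (a - α i * b) (α i * b)
      rw [sub_add_cancel] at h3
      exact lt_of_lt_of_le (lt_min hpos h1) h3
    exact absurd hab (lt_min h2 hbpos).ne'
  have hd : v ((α i - α j) * b) = v (α i - α j) := by rw [v.map_mul, hb, add_zero]
  apply le_antisymm
  · refine le_min (hi j) ?_
    have h3 := v.map_sub (a - α j * b) (a - α i * b)
    rw [show (a - α j * b) - (a - α i * b) = (α i - α j) * b by ring, hd,
      min_eq_left (hi j)] at h3
    exact h3
  · have h3 := v.map_add (a - α i * b) ((α i - α j) * b)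
    rw [show (a - α i * b) + (α i - α j) * b = a - α j * b by ring, hd] at h3
    exact h3

theorem aux_not_lt {L : Type*} [Field L] (v : AddValuation L (WithTop ℤ))
    (n : ℕ) (α d : Fin n → L) (a b a' b' : L) (i : Fin n)
    (heq : ∏ j, (a - α j * b) = ∏ j, (a' - α j * b'))
    (h1 : ∀ j, v (a - α j * b) = min (v (a - α i * b)) (v (d j)))
    (h2 : ∀ j, v (a' - α j * b') = min (v (a' - α i * b')) (v (d j))) :
    ¬ v (a - α i * b) < v (a' - α i * b') := by
  intro hlt
  have hle : ∀ s : Finset (Fin n),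
      v (∏ j ∈ s, (a - α j * b)) ≤ v (∏ j ∈ s, (a' - α j * b')) := by
    intro s
    induction s using Finset.induction_on with
    | empty => simp
    | insert k s hk ih =>
      rw [Finset.prod_insert hk, Finset.prod_insert hk, v.map_mul, v.map_mul]
      refine add_le_add ?_ ih
      rw [h1 k, h2 k]
      exact min_le_min_right _ hlt.le
  have hP : v (∏ j ∈ Finset.univ.erase i, (a - α j * b)) ≠ ⊤ := by
    rw [Ne, v.top_iff, Finset.prod_eq_zero_iff]
    rintro ⟨k, -, hk⟩
    have h3 := h1 k
    rw [hk, v.map_zero] at h3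
    have h4 : (⊤ : WithTop ℤ) ≤ v (a - α i * b) := h3 ▸ min_le_left _ _
    exact absurd (lt_of_le_of_lt h4 hlt) not_top_lt
  rw [← Finset.mul_prod_erase _ _ (Finset.mem_univ i),
    ← Finset.mul_prod_erase _ (fun j => a' - α j * b') (Finset.mem_univ i)] at heq
  have h5 := congrArg v heq
  rw [v.map_mul, v.map_mul] at h5
  exact absurd h5 (lt_of_lt_of_le (WithTop.add_lt_add_right hP hlt)
    (add_le_add le_rfl (hle _))).ne

/-- Lemma 2.11 of Lorenzini–Tucker: two primitive solutions of the Thue equation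
`∏ (x - αⱼ y) = h` that are both closest to the root `αᵢ` have the same distance to it. -/
theorem stmt7 (L : Type*) [Field L] (v : AddValuation L (WithTop ℤ))
    (n : ℕ) (hn : 1 ≤ n) (α : Fin n → L) (hα : ∀ j, 0 ≤ v (α j))
    (h : L) (hh : 0 < v h)
    (a b a' b' : L)
    (hab : min (v a) (v b) = 0) (hab' : min (v a') (v b') = 0)
    (heq : ∏ j, (a - α j * b) = h) (heq' : ∏ j, (a' - α j * b') = h)
    (i : Fin n)
    (hi : ∀ j, v (a - α j * b) ≤ v (a - α i * b))
    (hi' : ∀ j, v (a' - α j * b') ≤ v (a' - α i * b')) :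
    v (a - α i * b) = v (a' - α i * b') := by
  have h1 := aux_key v n α hα h hh a b hab heq i hi
  have h2 := aux_key v n α hα h hh a' b' hab' heq' i hi'
  exact le_antisymm
    (not_lt.mp (aux_not_lt v n α (fun j => α i - α j) a' b' a b i (heq'.trans heq.symm) h2 h1))
    (not_lt.mp (aux_not_lt v n α (fun j => α i - α j) a b a' b' i (heq.trans heq'.symm) h1 h2))
end
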